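/- arXiv:1806.06726 — 2 statements merged into one kernel-verified Lean document; each statement's English description precedes it below -/
import Mathlib

section
/- There exists a constant c > 1, independent of n and k, such that the following holds: let r : Fin n → ℕ be a family of independent geometric random variables with P(r(j) = m) = 1/2^{m+1}, let i be any index, and let T(r) be the (unique) zip tree on nodes with keys 0, …, n−1 and ranks r. Then for every k ∈ ℕ, the probability that the total number of nodes on the right spine of the left subtree of node i together with the left spine of the right subtree of node i exceeds k is at most 1/c^k. -/
open scoped ENNReal

/-- A binary tree whose nodes carry a key of type `α` and a natural-number rank. -/
inductive ZTree (α : Type) : Type where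
  | leaf : ZTree α
  | node (left : ZTree α) (key : α) (rank : ℕ) (right : ZTree α) : ZTree α

namespace ZTree
variable {α : Type} [LinearOrder α]

/-- The list of (key, rank) pairs of the nodes of the tree, in symmetric order. -/
def nodes : ZTree α → List (α × ℕ)
  | .leaf => []
  | .node l k rk r => l.nodes ++ (k, rk) :: r.nodes

/-- Binary-search-tree (symmetric order) property. -/
def isBST : ZTree α → Prop
  | .leaf => True
  | .node l k _ r =>
      (∀ p ∈ l.nodes, p.1 < k) ∧ (∀ p ∈ r.nodes, k < p.1) ∧ l.isBST ∧ r.isBST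

/-- The rank of the root node, if any. -/
def rootRank? : ZTree α → Option ℕ
  | .leaf => none
  | .node _ _ rk _ => some rk

/-- Max-heap order on ranks, ties broken in favor of smaller keys: every node's rank is
strictly greater than that of its left child and at least that of its right child. -/
def isRankHeap : ZTree α → Prop
  | .leaf => True
  | .node l _ rk r =>
      (∀ m ∈ l.rootRank?, m < rk) ∧ (∀ m ∈ r.rootRank?, m ≤ rk) ∧
        l.isRankHeap ∧ r.isRankHeap

/-- The zip-tree conditions: symmetric order on keys and heap order on ranks. -/
def isZipTree (t : ZTree α) : Prop := t.isBST ∧ t.isRankHeap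

/-- The (key, rank) pairs on the search path from the root to the node with key `a`. -/
def pathTo (a : α) : ZTree α → List (α × ℕ)
  | .leaf => []
  | .node l k rk r =>
      if a < k then (k, rk) :: l.pathTo a
      else if k < a then (k, rk) :: r.pathTo a
      else [(k, rk)]

/-- The depth (number of edges from the root) of the node with key `a`. -/
def depth (a : α) : ZTree α → ℕ
  | .leaf => 0
  | .node l k _ r =>
      if a < k then l.depth a + 1
      else if k < a then r.depth a + 1
      else 0

/-- The subtree rooted at the node with key `a`. -/
def subtreeAt (a : α) : ZTree α → ZTree α
  | .leaf => .leaf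
  | .node l k rk r =>
      if a < k then l.subtreeAt a
      else if k < a then r.subtreeAt a
      else .node l k rk r

/-- Number of nodes on the left spine (root through left children). -/
def leftSpineLen : ZTree α → ℕ
  | .leaf => 0
  | .node l _ _ _ => l.leftSpineLen + 1

/-- Number of nodes on the right spine (root through right children). -/
def rightSpineLen : ZTree α → ℕ
  | .leaf => 0
  | .node _ _ _ r => r.rightSpineLen + 1

/-- Total number of nodes on the right spine of the left subtree of the node with key `a`
together with the left spine of its right subtree: the paths zipped when deleting this
node, equivalently, the path unzipped when inserting it. -/
def zipSpineCount (a : α) (t : ZTree α) : ℕ :=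
  match t.subtreeAt a with
  | .leaf => 0
  | .node l _ _ r => l.rightSpineLen + r.leftSpineLen

end ZTree

namespace ZTree

variable {α : Type}

theorem exists_nodes_eq_of_subtreeAt [LinearOrder α] {a k : α} {rk : ℕ} {t l r : ZTree α}
    (ht : t.isRankHeap) (h : t.subtreeAt a = .node l k rk r) :
    (ZTree.node l k rk r).isRankHeap ∧
      ∃ A B, t.nodes = A ++ l.nodes ++ (a, rk) :: (r.nodes ++ B) := by
  induction t with
  | leaf => simp [subtreeAt] at h
  | node l' k' rk' r' ihl ihr =>
    have hheap := ht
    obtain ⟨-, -, hl, hr⟩ := ht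
    simp only [subtreeAt] at h
    split_ifs at h with h₁ h₂
    · obtain ⟨h₃, A, B, hAB⟩ := ihl hl h
      exact ⟨h₃, A, B ++ (k', rk') :: r'.nodes, by simp [nodes, hAB]⟩
    · obtain ⟨h₃, A, B, hAB⟩ := ihr hr h
      exact ⟨h₃, l'.nodes ++ (k', rk') :: A, B, by simp [nodes, hAB]⟩
    · have hk : k' = a := le_antisymm (not_lt.1 h₁) (not_lt.1 h₂)
      injection h with e₁ e₂ e₃ e₄
      subst e₁ e₂ e₃ e₄ hk
      exact ⟨hheap, [], [], by simp [nodes]⟩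

theorem isRankHeap.rank_le_root {t : ZTree α} (ht : t.isRankHeap) {b : ℕ}
    (hb : ∀ m ∈ t.rootRank?, m ≤ b) : ∀ p ∈ t.nodes, p.2 ≤ b := by
  induction t generalizing b with
  | leaf => simp [nodes]
  | node l k rk r ihl ihr =>
    obtain ⟨h₁, h₂, hl, hr⟩ := ht
    have hrk : rk ≤ b := hb rk rfl
    intro p hp
    simp only [nodes, List.mem_append, List.mem_cons] at hp
    rcases hp with hp | rfl | hp
    · exact (ihl hl (fun m hm => (h₁ m hm).le) p hp).trans hrk
    · exact hrk
    · exact (ihr hr h₂ p hp).trans hrk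

theorem isRankHeap.rank_lt {t : ZTree α} (ht : t.isRankHeap) {b : ℕ}
    (hb : ∀ m ∈ t.rootRank?, m < b) : ∀ p ∈ t.nodes, p.2 < b := by
  cases t with
  | leaf => simp [nodes]
  | node l k rk r =>
    intro p hp
    exact (ht.rank_le_root (b := rk) (by simp [rootRank?]) p hp).trans_lt (hb rk rfl)

theorem isRankHeap.leftSpineLen_le {t : ZTree α} (ht : t.isRankHeap) {b : ℕ}
    (hb : ∀ m ∈ t.rootRank?, m < b) : t.leftSpineLen ≤ b := by
  induction t generalizing b with
  | leaf => simp [leftSpineLen]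
  | node l k rk r ihl ihr =>
    obtain ⟨h₁, h₂, hl, hr⟩ := ht
    have := hb rk rfl
    have := ihl hl h₁
    simp only [leftSpineLen]
    omega

/-- The number of weak records of value at least `M` in a list, up to the first entry that is
at least `m`. -/
def weakRecords (m : ℕ) : ℕ → List ℕ → ℕ
  | _, [] => 0
  | M, a :: s =>
      if m ≤ a then 0 else if M ≤ a then weakRecords m a s + 1 else weakRecords m M s

theorem weakRecords_append_of_lt {m M : ℕ} (hM : M ≤ m) (u s : List ℕ) (hu : ∀ a ∈ u, a < M) :
    weakRecords m M (u ++ s) = weakRecords m M s := by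
  induction u with
  | nil => rfl
  | cons a u ih =>
    have ha := hu a (by simp)
    rw [List.cons_append, weakRecords, if_neg (by omega), if_neg (by omega)]
    exact ih fun b hb => hu b (by simp [hb])

theorem isRankHeap.weakRecords_append {t : ZTree α} (ht : t.isRankHeap) {m : ℕ}
    (hm : ∀ b ∈ t.rootRank?, b < m) (s : List ℕ) :
    weakRecords m 0 ((t.nodes.map Prod.snd).reverse ++ s) =
      t.rightSpineLen + weakRecords m (t.rootRank?.getD 0) s := by
  induction t generalizing s with
  | leaf => simp [nodes, rightSpineLen, rootRank?]
  | node l k rk r ihl ihr =>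
    obtain ⟨h₁, h₂, hl, hr⟩ := ht
    have hrk : rk < m := hm rk rfl
    have hroot : r.rootRank?.getD 0 ≤ rk := by
      cases h : r.rootRank? with
      | none => simp
      | some b => simpa using h₂ b h
    have hskip := weakRecords_append_of_lt hrk.le (l.nodes.map Prod.snd).reverse s (by
      intro a ha
      rw [List.mem_reverse, List.mem_map] at ha
      obtain ⟨p, hp, rfl⟩ := ha
      exact hl.rank_lt h₁ p hp)
    have := ihr hr (fun b hb => (h₂ b hb).trans_lt hrk)
      (rk :: ((l.nodes.map Prod.snd).reverse ++ s))
    rw [weakRecords, if_neg (by omega), if_pos hroot, hskip] at this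
    simp only [nodes, rightSpineLen, rootRank?, Option.getD_some, List.map_append, List.map_cons,
      List.reverse_append, List.reverse_cons, List.append_assoc, List.cons_append, List.nil_append]
    rw [this]
    omega

theorem isBST.pairwise_nodes [LinearOrder α] {t : ZTree α} (ht : t.isBST) :
    t.nodes.Pairwise fun p q => p.1 < q.1 := by
  induction t with
  | leaf => simp [nodes]
  | node l k rk r ihl ihr =>
    obtain ⟨h₁, h₂, hl, hr⟩ := ht
    rw [nodes, List.pairwise_append, List.pairwise_cons]
    refine ⟨ihl hl, ⟨h₂, ihr hr⟩, fun p hp q hq => ?_⟩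
    rcases List.mem_cons.1 hq with rfl | hq
    · exact h₁ p hp
    · exact (h₁ p hp).trans (h₂ q hq)

theorem isBST.nodes_eq {n : ℕ} {t : ZTree ℕ} (ht : t.isBST) {f : Fin n → ℕ}
    (hp : t.nodes.Perm ((List.finRange n).map fun j : Fin n => ((j : ℕ), f j))) :
    t.nodes = (List.finRange n).map fun j : Fin n => ((j : ℕ), f j) := by
  refine hp.eq_of_pairwise (le := fun p q => p.1 < q.1)
    (fun p q _ _ h₁ h₂ => absurd h₁ h₂.asymm) ht.pairwise_nodes ?_
  rw [List.pairwise_map]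
  exact List.pairwise_lt_finRange n

theorem isZipTree.zipSpineCount_le {n : ℕ} {t : ZTree ℕ} (ht : t.isZipTree) {f : Fin n → ℕ}
    (hp : t.nodes.Perm ((List.finRange n).map fun j : Fin n => ((j : ℕ), f j))) (i : Fin n) :
    t.zipSpineCount (i : ℕ) ≤
      weakRecords (f i) 0 ((List.ofFn f).take i).reverse + f i + 1 := by
  have hnodes := ht.1.nodes_eq hp
  rw [zipSpineCount]
  split
  · omega
  · rename_i l k rk r hsub
    obtain ⟨⟨h₁, h₂, hl, hr⟩, A, B, hAB⟩ := exists_nodes_eq_of_subtreeAt ht.2 hsub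
    rw [hnodes] at hAB
    have hget := congrArg (fun L => L[(A ++ l.nodes).length]?) hAB
    simp only [List.getElem?_append_right le_rfl, Nat.sub_self, List.getElem?_cons_zero,
      List.getElem?_map, Option.map_eq_some_iff] at hget
    obtain ⟨j, hj, hjeq⟩ := hget
    obtain ⟨hj₁, hj₂⟩ := Prod.mk.inj hjeq
    obtain rfl : j = i := Fin.ext hj₁
    have hlen : (A ++ l.nodes).length = j := by
      obtain ⟨hlt, hj⟩ := List.getElem?_eq_some_iff.1 hj
      rw [← hj]
      simp
    have hofFn : List.ofFn f =
        ((List.finRange n).map fun j : Fin n => ((j : ℕ), f j)).map Prod.snd := by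
      rw [List.map_map, List.ofFn_eq_map]
      rfl
    have htake : (List.ofFn f).take j = (A ++ l.nodes).map Prod.snd := by
      rw [hofFn, hAB, ← hlen, ← List.map_take, List.take_left]
    rw [htake, List.map_append, List.reverse_append, hj₂, hl.weakRecords_append h₁]
    have := hr.leftSpineLen_le (b := rk + 1) fun m hm => Nat.lt_succ_of_le (h₂ m hm)
    omega

end ZTree

open ZTree

/-- The probability that independent geometric variables of mean 1 take the values `f`. -/
noncomputable def geomWeight {n : ℕ} (f : Fin n → ℕ) : ℝ≥0∞ :=
  ∏ j : Fin n, (1 / 2 : ℝ≥0∞) ^ (f j + 1)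

theorem tsum_geomWeight_snoc {n : ℕ} (φ : (Fin (n + 1) → ℕ) → ℝ≥0∞) :
    ∑' f, geomWeight f * φ f =
      ∑' m : ℕ, (1 / 2 : ℝ≥0∞) ^ (m + 1) *
        ∑' g : Fin n → ℕ, geomWeight g * φ (Fin.snoc g m) := by
  rw [← (Fin.snocEquiv fun _ : Fin (n + 1) => ℕ).tsum_eq, ENNReal.tsum_prod']
  refine tsum_congr fun m => ?_
  rw [← ENNReal.tsum_mul_left]
  refine tsum_congr fun g => ?_
  have : geomWeight (Fin.snoc g m : Fin (n + 1) → ℕ) = geomWeight g * (1 / 2) ^ (m + 1) := by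
    simp [geomWeight, Fin.prod_univ_castSucc]
  change geomWeight (Fin.snoc g m : Fin (n + 1) → ℕ) * φ (Fin.snoc g m) = _
  rw [this]
  ring

theorem tsum_half_pow_succ_mul (φ : ℕ → ℝ≥0∞) :
    ∑' m : ℕ, (1 / 2 : ℝ≥0∞) ^ (m + 1) * φ m =
      1 / 2 * φ 0 + 1 / 2 * ∑' m : ℕ, (1 / 2 : ℝ≥0∞) ^ (m + 1) * φ (m + 1) := by
  rw [tsum_eq_zero_add' ENNReal.summable, ← ENNReal.tsum_mul_left]
  congr 1
  · simp
  · exact tsum_congr fun m => by ring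

theorem tsum_half_pow_succ : ∑' m : ℕ, (1 / 2 : ℝ≥0∞) ^ (m + 1) = 1 := by
  rw [ENNReal.tsum_geometric_add_one, one_div, ENNReal.one_sub_inv_two, inv_inv]
  exact ENNReal.inv_mul_cancel (by simp) (by simp)

theorem tsum_geomWeight (n : ℕ) : ∑' f : Fin n → ℕ, geomWeight f = 1 := by
  induction n with
  | zero => simp [geomWeight]
  | succ n ih =>
    have := tsum_geomWeight_snoc (n := n) fun _ => 1
    simpa only [mul_one, ih, tsum_half_pow_succ] using this

theorem tsum_geomWeight_take {n : ℕ} (i : Fin n) (φ : List ℕ → ℕ → ℝ≥0∞) :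
    ∑' f : Fin n → ℕ, geomWeight f * φ ((List.ofFn f).take i) (f i) =
      ∑' m : ℕ, (1 / 2 : ℝ≥0∞) ^ (m + 1) *
        ∑' g : Fin i → ℕ, geomWeight g * φ (List.ofFn g) m := by
  induction n with
  | zero => exact i.elim0
  | succ n ih =>
    rw [tsum_geomWeight_snoc]
    have hofFn (g : Fin n → ℕ) (m : ℕ) :
        List.ofFn (Fin.snoc g m : Fin (n + 1) → ℕ) = List.ofFn g ++ [m] := by
      rw [List.ofFn_succ']
      simp
    induction i using Fin.lastCases with
    | last =>
      refine tsum_congr fun m => ?_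
      simp only [hofFn, Fin.snoc_last, Fin.val_last]
      congr 1
      refine tsum_congr fun g => ?_
      rw [List.take_left' (List.length_ofFn)]
    | cast j =>
      have (g : Fin n → ℕ) (m : ℕ) :
          (List.ofFn (Fin.snoc g m : Fin (n + 1) → ℕ)).take j = (List.ofFn g).take j := by
        rw [hofFn, List.take_append_of_le_length (by simp [j.2.le])]
      simp only [Fin.snoc_castSucc, Fin.val_castSucc, this, ih, ENNReal.tsum_mul_right,
        tsum_half_pow_succ, one_mul]

theorem tsum_weakRecords_step {x y : ℝ≥0∞} (hxy : 1 / 2 * (x * y) + 1 / 2 = y)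
    {m M : ℕ} (hM : M ≤ m) :
    ∑' a : ℕ, (1 / 2 : ℝ≥0∞) ^ (a + 1) *
      (if m ≤ a then 1 else if M ≤ a then x * y ^ (m - a) else y ^ (m - M)) = y ^ (m - M) := by
  induction m generalizing M with
  | zero =>
    obtain rfl : M = 0 := by omega
    simpa using tsum_half_pow_succ
  | succ m ih =>
    rw [tsum_half_pow_succ_mul]
    cases M with
    | zero =>
      have := ih (Nat.zero_le m)
      simp only [Nat.zero_le, if_true, Nat.sub_zero] at this
      simp only [Nat.zero_le, if_true, Nat.sub_zero, Nat.add_le_add_iff_right,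
        Nat.add_sub_add_right, this, Nat.not_add_one_le_zero, if_false]
      calc _ = (1 / 2 * (x * y) + 1 / 2) * y ^ m := by ring
        _ = _ := by rw [hxy, pow_succ']
    | succ M =>
      have := ih (Nat.le_of_succ_le_succ hM)
      simp only [Nat.add_le_add_iff_right, Nat.add_sub_add_right, this, Nat.not_add_one_le_zero,
        if_false]
      rw [← add_mul, one_div, ENNReal.inv_two_add_inv_two, one_mul]

theorem tsum_geomWeight_weakRecords_le {x y : ℝ≥0∞} (hxy : 1 / 2 * (x * y) + 1 / 2 = y)
    (hy : 1 ≤ y) (n : ℕ) {m M : ℕ} (hM : M ≤ m) :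
    ∑' g : Fin n → ℕ, geomWeight g * x ^ weakRecords m M (List.ofFn g).reverse ≤ y ^ (m - M) := by
  induction n generalizing M with
  | zero => simpa [geomWeight, weakRecords] using one_le_pow₀ hy
  | succ n ih =>
    rw [tsum_geomWeight_snoc]
    refine le_trans (ENNReal.tsum_le_tsum fun a => ?_) (tsum_weakRecords_step hxy hM).le
    gcongr
    have hofFn (g : Fin n → ℕ) :
        (List.ofFn (Fin.snoc g a : Fin (n + 1) → ℕ)).reverse = a :: (List.ofFn g).reverse := by
      rw [List.ofFn_succ']
      simp
    simp only [hofFn, weakRecords]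
    split_ifs with h₁ h₂
    · simp [tsum_geomWeight]
    · simp only [pow_succ', mul_left_comm _ x, ENNReal.tsum_mul_left]
      gcongr
      exact ih (by omega)
    · exact ih hM

theorem tsum_geomWeight_pow_le {n : ℕ} (i : Fin n) :
    ∑' f : Fin n → ℕ, geomWeight f *
      (5 / 4 : ℝ≥0∞) ^ (weakRecords (f i) 0 ((List.ofFn f).take i).reverse + f i) ≤ 3 := by
  rw [tsum_geomWeight_take i fun l m => (5 / 4 : ℝ≥0∞) ^ (weakRecords m 0 l.reverse + m)]
  have hxy : (1 / 2 : ℝ≥0∞) * (5 / 4 * (4 / 3)) + 1 / 2 = 4 / 3 := by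
    rw [← ENNReal.toReal_eq_toReal_iff' (by finiteness) (by finiteness)]
    rw [ENNReal.toReal_add (by finiteness) (by finiteness)]
    norm_num
  have hy : (1 : ℝ≥0∞) ≤ 4 / 3 := by
    rw [ENNReal.le_div_iff_mul_le (by simp) (by simp)]
    norm_num
  have hterm (m : ℕ) : (1 / 2 : ℝ≥0∞) ^ (m + 1) * (∑' g : Fin i → ℕ, geomWeight g *
      (5 / 4 : ℝ≥0∞) ^ (weakRecords m 0 (List.ofFn g).reverse + m)) ≤
        1 / 2 * (5 / 6 : ℝ≥0∞) ^ m := by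
    have h56 : (5 / 6 : ℝ≥0∞) = 1 / 2 * (4 / 3) * (5 / 4) := by
      rw [← ENNReal.toReal_eq_toReal_iff' (by finiteness) (by finiteness)]
      norm_num
    simp only [pow_add, ← mul_assoc, ENNReal.tsum_mul_right]
    calc _ ≤ (1 / 2 : ℝ≥0∞) ^ m * (1 / 2) ^ 1 * (4 / 3) ^ (m - 0) * (5 / 4) ^ m := by
          rw [mul_assoc _ (∑' _, _), mul_assoc _ ((4 / 3 : ℝ≥0∞) ^ _)]
          gcongr
          exact tsum_geomWeight_weakRecords_le hxy hy _ (Nat.zero_le m)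
      _ = _ := by rw [h56, mul_pow, mul_pow, Nat.sub_zero]; ring
  refine (ENNReal.tsum_le_tsum hterm).trans ?_
  rw [ENNReal.tsum_mul_left, ENNReal.tsum_geometric]
  have h6 : (1 - 5 / 6 : ℝ≥0∞) = 6⁻¹ := by
    refine ENNReal.sub_eq_of_eq_add (by finiteness) ?_
    rw [← ENNReal.toReal_eq_toReal_iff' (by finiteness) (by finiteness)]
    rw [ENNReal.toReal_add (by finiteness) (by finiteness)]
    norm_num
  rw [h6, inv_inv, ← ENNReal.toReal_le_toReal (by finiteness) (by finiteness)]
  norm_num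

theorem tsum_geomWeight_ne_zero_le {n : ℕ} (i : Fin n) :
    ∑' f : Fin n → ℕ, geomWeight f * (if f i = 0 then 0 else 1) ≤ 1 / 2 := by
  rw [tsum_geomWeight_take i fun _ m => if m = 0 then 0 else 1, tsum_half_pow_succ_mul]
  simp only [if_true, mul_zero, tsum_zero, zero_add, Nat.succ_ne_zero, if_false, mul_one,
    tsum_geomWeight, tsum_half_pow_succ, le_refl]

theorem min_half_three_div_le (k : ℕ) :
    min (1 / 2 : ℝ) (3 / (5 / 4) ^ k) ≤ 1 / (109 / 100) ^ k := by
  rcases Nat.lt_or_ge k 9 with h | h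
  · refine (min_le_left _ _).trans ?_
    refine one_div_le_one_div_of_le (by positivity) ?_
    calc (109 / 100 : ℝ) ^ k ≤ (109 / 100) ^ 8 := pow_le_pow_right₀ (by norm_num) (by omega)
      _ ≤ 2 := by norm_num
  · refine (min_le_right _ _).trans ?_
    rw [div_le_div_iff₀ (by positivity) (by positivity), one_mul, ← le_div_iff₀ (by positivity),
      ← div_pow]
    calc (3 : ℝ) ≤ (5 / 4 / (109 / 100)) ^ 9 := by norm_num
      _ ≤ _ := pow_le_pow_right₀ (by norm_num) h

/-- **Restructuring cost tail bound (Theorem 4, high-probability part).** There is a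
constant `c > 1`, independent of `n` and `k`, such that: if `r : Fin n → ℕ` are
independent geometric random variables with `P(r j = m) = 1/2^(m+1)` (modelled by the
product PMF `μ`), `i` is any index, and `T r` is the (unique) zip tree on nodes with
keys `0, …, n−1` and ranks `r`, then for every `k ∈ ℕ` the probability that the total
number of nodes on the right spine of the left subtree of node `i` together with the
left spine of the right subtree of node `i` exceeds `k` is at most `1/c^k`. -/
theorem zip_path_nodes_tail :
    ∃ c : ℝ, 1 < c ∧
      ∀ (n : ℕ) (μ : PMF (Fin n → ℕ)),
        (∀ f : Fin n → ℕ, μ f = ∏ j : Fin n, (1 / 2 : ℝ≥0∞) ^ (f j + 1)) →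
      ∀ (T : (Fin n → ℕ) → ZTree ℕ),
        (∀ f : Fin n → ℕ, (T f).isZipTree ∧
          (T f).nodes.Perm ((List.finRange n).map fun j : Fin n => ((j : ℕ), f j))) →
      ∀ (i : Fin n) (k : ℕ),
        μ.toOuterMeasure {f : Fin n → ℕ | k < (T f).zipSpineCount (i : ℕ)} ≤
          ENNReal.ofReal (1 / c ^ k) := by
  refine ⟨109 / 100, by norm_num, fun n μ hμ T hT i k => ?_⟩
  rcases eq_or_ne k 0 with rfl | hk
  · simpa using (μ.toOuterMeasure_apply _).trans_le
      ((ENNReal.tsum_le_tsum fun f => Set.indicator_le_self _ _ f).trans μ.tsum_coe.le)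
  have hcount (f : Fin n → ℕ) (hf : k < (T f).zipSpineCount (i : ℕ)) :
      k ≤ weakRecords (f i) 0 ((List.ofFn f).take i).reverse + f i := by
    have := (hT f).1.zipSpineCount_le (hT f).2 i
    omega
  have hbound (φ : (Fin n → ℕ) → ℝ≥0∞)
      (hφ : ∀ f, k < (T f).zipSpineCount (i : ℕ) → 1 ≤ φ f) :
      μ.toOuterMeasure {f : Fin n → ℕ | k < (T f).zipSpineCount (i : ℕ)} ≤
        ∑' f, geomWeight f * φ f := by
    rw [PMF.toOuterMeasure_apply]
    refine ENNReal.tsum_le_tsum fun f => Set.indicator_apply_le' (fun hf => ?_) fun _ => zero_le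
    rw [hμ f]
    exact le_mul_of_one_le_right' (hφ f hf)
  have hhalf : μ.toOuterMeasure {f : Fin n → ℕ | k < (T f).zipSpineCount (i : ℕ)} ≤
      ENNReal.ofReal (1 / 2) := by
    refine (hbound _ fun f hf => ?_).trans ((tsum_geomWeight_ne_zero_le i).trans ?_)
    · rw [if_neg]
      intro h0
      have := hcount f hf
      have hzero : ∀ l, weakRecords 0 0 l = 0 := by
        intro l
        cases l <;> simp [weakRecords]
      rw [h0, hzero] at this
      omega
    · rw [ENNReal.ofReal_div_of_pos (by norm_num)]
      simp
  have hmarkov : μ.toOuterMeasure {f : Fin n → ℕ | k < (T f).zipSpineCount (i : ℕ)} ≤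
      ENNReal.ofReal (3 / (5 / 4) ^ k) := by
    have h54 : ENNReal.ofReal ((5 / 4) ^ k) = (5 / 4 : ℝ≥0∞) ^ k := by
      rw [ENNReal.ofReal_pow (by norm_num), ENNReal.ofReal_div_of_pos (by norm_num)]
      simp
    have h1 : (1 : ℝ≥0∞) ≤ 5 / 4 := by
      rw [ENNReal.le_div_iff_mul_le (by simp) (by simp)]
      norm_num
    rw [ENNReal.ofReal_div_of_pos (by positivity), h54, ENNReal.ofReal_ofNat]
    refine (hbound (fun f => (5 / 4 : ℝ≥0∞) ^
      (weakRecords (f i) 0 ((List.ofFn f).take i).reverse + f i) / (5 / 4 : ℝ≥0∞) ^ k)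
      fun f hf => ?_).trans ?_
    · rw [ENNReal.le_div_iff_mul_le (by left; positivity) (by left; finiteness), one_mul]
      exact pow_le_pow_right₀ h1 (hcount f hf)
    · simp only [div_eq_mul_inv _ ((5 / 4 : ℝ≥0∞) ^ k), ← mul_assoc, ENNReal.tsum_mul_right]
      gcongr
      exact tsum_geomWeight_pow_le i
  refine le_trans ?_ (ENNReal.ofReal_le_ofReal (min_half_three_div_le k))
  rw [ENNReal.ofReal_min]
  exact le_min hhalf hmarkov
end

section
/- Let k ∈ ℕ, let i be a fixed index in Fin n, let the ranks r(j) for j ≠ i be independent geometric random variables with P(r(j) = m) = 1/2^{m+1}, let r(i) = k, and let T(r) be the (unique) zip tree on nodes with keys 0, …, n−1 and ranks r. Then the expected number of descendants of node i in T(r), including node i itself, is at most 3·2^k − 1. -/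
open scoped ENNReal

namespace ZTree

theorem rank_le_of_mem_nodes {α : Type} {t : ZTree α} (ht : t.isRankHeap) {b : ℕ}
    (hb : ∀ m ∈ t.rootRank?, m ≤ b) {p : α × ℕ} (hp : p ∈ t.nodes) : p.2 ≤ b := by
  induction t generalizing b with
  | leaf => simp [nodes] at hp
  | node l k rk r ihl ihr =>
    obtain ⟨hl, hr, hhl, hhr⟩ := ht
    have hrk : rk ≤ b := hb rk rfl
    simp only [nodes, List.mem_append, List.mem_cons] at hp
    rcases hp with hp | rfl | hp
    · exact ihl hhl (fun m hm => (hl m hm).le.trans hrk) hp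
    · exact hrk
    · exact ihr hhr (fun m hm => (hr m hm).trans hrk) hp

theorem rank_lt_of_mem_nodes {α : Type} {t : ZTree α} (ht : t.isRankHeap) {b : ℕ}
    (hb : ∀ m ∈ t.rootRank?, m < b) {p : α × ℕ} (hp : p ∈ t.nodes) : p.2 < b := by
  cases t with
  | leaf => simp [nodes] at hp
  | node l k rk r =>
    exact (rank_le_of_mem_nodes ht (b := rk) (by simp [rootRank?]) hp).trans_lt (hb rk rfl)

variable {α : Type} [LinearOrder α]

theorem nodes_subtreeAt_sublist (a : α) (t : ZTree α) :
    (t.subtreeAt a).nodes.Sublist t.nodes := by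
  induction t with
  | leaf => simp [subtreeAt]
  | node l k rk r ihl ihr =>
    simp only [subtreeAt]
    split_ifs
    · exact ihl.trans (List.sublist_append_left _ _)
    · exact (ihr.trans (List.sublist_cons_self _ _)).trans (List.sublist_append_right _ _)
    · exact List.Sublist.refl _

/-- In a zip tree, every node whose key lies between the key of a node and that of one of its
descendants respects the rank bound imposed by the upper node. -/
theorem isZipTree.rank_bound_of_mem_subtreeAt {t : ZTree α} (ht : t.isZipTree) {a : α} {ρ : ℕ}
    (ha : (a, ρ) ∈ t.nodes) {p q : α × ℕ} (hp : p ∈ (t.subtreeAt a).nodes) (hq : q ∈ t.nodes) :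
    (p.1 ≤ q.1 → q.1 < a → q.2 < ρ) ∧ (a < q.1 → q.1 ≤ p.1 → q.2 ≤ ρ) := by
  obtain ⟨hbst, hheap⟩ := ht
  induction t with
  | leaf => simp [nodes] at ha
  | node l k rk r ihl ihr =>
    obtain ⟨hlk, hkr, hbl, hbr⟩ := hbst
    obtain ⟨hl, hr, hhl, hhr⟩ := hheap
    simp only [nodes, List.mem_append, List.mem_cons] at ha hq
    simp only [subtreeAt] at hp
    split_ifs at hp with h1 h2
    · have ha' : (a, ρ) ∈ l.nodes := by
        rcases ha with ha | ha | ha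
        · exact ha
        · exact absurd (congrArg Prod.fst ha) h1.ne
        · exact absurd (hkr _ ha) h1.not_gt
      have hpk := hlk _ ((nodes_subtreeAt_sublist a l).subset hp)
      rcases hq with hq | rfl | hq
      · exact ihl ha' hp hq hbl hhl
      · exact ⟨fun _ h => absurd h h1.not_gt, fun _ h => absurd h hpk.not_ge⟩
      · have := hkr _ hq
        exact ⟨fun _ h => absurd (this.trans h) h1.not_gt,
          fun _ h => absurd (this.trans_le h) hpk.not_gt⟩
    · have ha' : (a, ρ) ∈ r.nodes := by
        rcases ha with ha | ha | ha
        · exact absurd (hlk _ ha) h2.not_gt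
        · exact absurd (congrArg Prod.fst ha) h2.ne'
        · exact ha
      have hpk := hkr _ ((nodes_subtreeAt_sublist a r).subset hp)
      rcases hq with hq | rfl | hq
      · have := hlk _ hq
        exact ⟨fun h _ => absurd (h.trans_lt this) hpk.not_gt,
          fun h _ => absurd (h.trans this) h2.not_gt⟩
      · exact ⟨fun h _ => absurd h hpk.not_ge, fun h _ => absurd h h2.not_gt⟩
      · exact ihr ha' hp hq hbr hhr
    · obtain rfl : a = k := le_antisymm (not_lt.1 h2) (not_lt.1 h1)
      obtain rfl : ρ = rk := by
        rcases ha with ha | ha | ha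
        · exact absurd (hlk _ ha) (lt_irrefl _)
        · exact congrArg Prod.snd ha
        · exact absurd (hkr _ ha) (lt_irrefl _)
      rcases hq with hq | rfl | hq
      · exact ⟨fun _ _ => rank_lt_of_mem_nodes hhl hl hq,
          fun h _ => absurd h (hlk _ hq).not_gt⟩
      · exact ⟨fun _ h => absurd h (lt_irrefl _), fun h _ => absurd h (lt_irrefl _)⟩
      · exact ⟨fun _ h => absurd h (hkr _ hq).not_gt,
          fun _ _ => rank_le_of_mem_nodes hhr hr hq⟩

end ZTree

theorem ENNReal.tsum_pi_prod {ι : Type*} [Fintype ι] {β : Type*} (f : ι → β → ℝ≥0∞) :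
    ∑' g : ι → β, ∏ j, f j (g j) = ∏ j, ∑' x, f j x := by
  classical
  revert f
  refine Fintype.induction_empty_option
    (P := fun ι _ => ∀ f : ι → β → ℝ≥0∞, ∑' g : ι → β, ∏ j, f j (g j) = ∏ j, ∑' x, f j x)
    ?_ ?_ ?_ ι
  · intro γ δ _ e h f
    let : Fintype γ := Fintype.ofEquiv δ e.symm
    have := h (fun j => f (e j))
    rw [← (e.arrowCongr (Equiv.refl β)).tsum_eq, ← e.prod_comp, ← this]
    refine tsum_congr fun g => ?_
    rw [← e.prod_comp]
    simp
  · intro f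
    simp
  · intro γ _ h f
    rw [← (Equiv.piOptionEquivProd (β := fun _ => β)).symm.tsum_eq, ENNReal.tsum_prod',
      Fintype.prod_option, ← h, ← ENNReal.tsum_mul_right]
    refine tsum_congr fun x => ?_
    rw [← ENNReal.tsum_mul_left]
    refine tsum_congr fun g => ?_
    simp [Fintype.prod_option, Equiv.piOptionEquivProd]

/-- The probability that a geometric variable of mean `1` is less than `m`. -/
noncomputable def geomLT (m : ℕ) : ℝ≥0∞ := ∑ x ∈ Finset.range m, (1 / 2 : ℝ≥0∞) ^ (x + 1)

theorem geomLT_add (m : ℕ) : geomLT m + (2 ^ m)⁻¹ = 1 := by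
  induction m with
  | zero => simp [geomLT]
  | succ m ih =>
    rw [geomLT, Finset.sum_range_succ, ← geomLT, add_assoc]
    refine Eq.trans (congrArg (geomLT m + ·) ?_) ih
    rw [one_div, ← ENNReal.inv_pow, ← two_mul, pow_succ, ENNReal.mul_inv (by simp) (by simp),
      mul_left_comm, ENNReal.mul_inv_cancel (by simp) (by simp), mul_one]

theorem tsum_geomLT_pow (m : ℕ) : ∑' d : ℕ, geomLT m ^ d = 2 ^ m := by
  have h : 1 - geomLT m = (2 ^ m)⁻¹ := by
    rw [← geomLT_add m]
    refine ENNReal.add_sub_cancel_left (ne_top_of_le_ne_top ENNReal.one_ne_top ?_)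
    rw [← geomLT_add m]
    exact le_self_add
  rw [ENNReal.tsum_geometric, h, inv_inv]

theorem tsum_geom_eq_one : ∑' x : ℕ, (1 / 2 : ℝ≥0∞) ^ (x + 1) = 1 := by
  simp_rw [pow_succ]
  rw [ENNReal.tsum_mul_right, ENNReal.tsum_geometric, one_div, ENNReal.one_sub_inv_two, inv_inv,
    ENNReal.mul_inv_cancel (by simp) (by simp)]

theorem tsum_geom_indicator {ι : Type*} [Fintype ι] [DecidableEq ι] (A : Finset ι) (m : ℕ) :
    ∑' g : ι → ℕ, (∏ j, (1 / 2 : ℝ≥0∞) ^ (g j + 1)) * (if ∀ j ∈ A, g j < m then 1 else 0) =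
      geomLT m ^ A.card := by
  have key : ∀ g : ι → ℕ,
      (∏ j, (1 / 2 : ℝ≥0∞) ^ (g j + 1)) * (if ∀ j ∈ A, g j < m then 1 else 0) =
        ∏ j, (1 / 2 : ℝ≥0∞) ^ (g j + 1) * (if j ∈ A → g j < m then 1 else 0) := by
    intro g
    rw [Finset.prod_mul_distrib]
    congr 1
    rw [Finset.prod_ite_zero]
    simp
  simp_rw [key]
  rw [ENNReal.tsum_pi_prod
    (fun j x => (1 / 2 : ℝ≥0∞) ^ (x + 1) * (if j ∈ A → x < m then 1 else 0))]
  have hj : ∀ j, (∑' x : ℕ, (1 / 2 : ℝ≥0∞) ^ (x + 1) * (if j ∈ A → x < m then 1 else 0)) =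
      if j ∈ A then geomLT m else 1 := by
    intro j
    split_ifs with h
    · simp only [h, true_imp_iff]
      rw [tsum_eq_sum (s := Finset.range m)]
      · exact Finset.sum_congr rfl fun x hx => by simp [Finset.mem_range.1 hx]
      · intro x hx
        simp [Finset.mem_range] at hx
        simp [hx]
    · simpa [h] using tsum_geom_eq_one
  simp_rw [hj]
  rw [Finset.prod_ite_mem, Finset.univ_inter, Finset.prod_const]

theorem sum_pow_le_tsum_of_injOn {γ : Type*} (s : Finset γ) (e : γ → ℕ) (he : Set.InjOn e s)
    (p : ℝ≥0∞) : ∑ j ∈ s, p ^ e j ≤ ∑' d : ℕ, p ^ d := by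
  rw [← Finset.sum_image (g := e) (f := fun d => p ^ d) he]
  exact ENNReal.sum_le_tsum _

/-- The subtree at `i` is confined to the maximal interval around `i` whose ranks are below `k` on
the left and at most `k` on the right. -/
theorem length_subtreeAt_add_one_le {n k : ℕ} {i : Fin n} {g : {j : Fin n // j ≠ i} → ℕ}
    {t : ZTree ℕ} (ht : t.isZipTree)
    (hperm : t.nodes.Perm ((List.finRange n).map
      fun j : Fin n => ((j : ℕ), if h : j = i then k else g ⟨j, h⟩))) :
    (t.subtreeAt (i : ℕ)).nodes.length + 1 ≤
      ((Finset.Iic i).filter fun j => ∀ q ∈ (Finset.Ico j i).subtype (· ≠ i), g q < k).card +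
      ((Finset.Ici i).filter fun j => ∀ q ∈ (Finset.Ioc i j).subtype (· ≠ i), g q < k + 1).card := by
  set A := (Finset.Iic i).filter fun j => ∀ q ∈ (Finset.Ico j i).subtype (· ≠ i), g q < k
  set B := (Finset.Ici i).filter fun j => ∀ q ∈ (Finset.Ioc i j).subtype (· ≠ i), g q < k + 1
  have hinter : 1 ≤ (A ∩ B).card := by
    refine Finset.card_pos.2 ⟨i, ?_⟩
    simp only [A, B, Finset.mem_inter, Finset.mem_filter, Finset.mem_Iic, Finset.mem_Ici, le_refl,
      Finset.Ico_self, Finset.Ioc_self, Finset.mem_subtype, Finset.notMem_empty,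
      false_imp_iff, implies_true, and_self]
  have hi : ((i : ℕ), k) ∈ t.nodes :=
    hperm.mem_iff.2 (List.mem_map.2 ⟨i, List.mem_finRange i, by simp⟩)
  have hmem : ∀ q : {j : Fin n // j ≠ i}, (((q : Fin n) : ℕ), g q) ∈ t.nodes := fun q =>
    hperm.mem_iff.2 (List.mem_map.2 ⟨q, List.mem_finRange _, by simp [q.2]⟩)
  have hnodup : ((t.subtreeAt (i : ℕ)).nodes.map Prod.fst).Nodup := by
    refine List.Nodup.sublist ((ZTree.nodes_subtreeAt_sublist _ t).map _) ?_
    rw [(hperm.map Prod.fst).nodup_iff, List.map_map]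
    exact (List.nodup_finRange n).map Fin.val_injective
  have hsub : ((t.subtreeAt (i : ℕ)).nodes.map Prod.fst).toFinset ⊆ (A ∪ B).image Fin.val := by
    intro a ha
    obtain ⟨p, hp, rfl⟩ := List.mem_map.1 (List.mem_toFinset.1 ha)
    obtain ⟨j, -, hj⟩ := List.mem_map.1
      (hperm.subset ((ZTree.nodes_subtreeAt_sublist _ t).subset hp))
    have hjp : (j : ℕ) = p.1 := congrArg Prod.fst hj
    refine Finset.mem_image.2 ⟨j, ?_, hjp⟩
    have hbound := fun q : {j : Fin n // j ≠ i} => ht.rank_bound_of_mem_subtreeAt hi hp (hmem q)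
    simp only [← hjp, Fin.val_fin_le, Fin.val_fin_lt] at hbound
    rcases le_total j i with h | h
    · refine Finset.mem_union_left _ (Finset.mem_filter.2 ⟨Finset.mem_Iic.2 h, fun q hq => ?_⟩)
      rw [Finset.mem_subtype, Finset.mem_Ico] at hq
      exact (hbound q).1 hq.1 hq.2
    · refine Finset.mem_union_right _ (Finset.mem_filter.2 ⟨Finset.mem_Ici.2 h, fun q hq => ?_⟩)
      rw [Finset.mem_subtype, Finset.mem_Ioc] at hq
      exact Nat.lt_succ_of_le ((hbound q).2 hq.1 hq.2)
  have hlen : (t.subtreeAt (i : ℕ)).nodes.length ≤ (A ∪ B).card := by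
    rw [← List.length_map (f := Prod.fst), ← List.toFinset_card_of_nodup hnodup]
    exact (Finset.card_le_card hsub).trans Finset.card_image_le
  have := Finset.card_union_add_card_inter A B
  omega

theorem tsum_geom_card_filter_le {ι γ : Type*} [Fintype ι] [DecidableEq ι] (s : Finset γ)
    (S : γ → Finset ι) (hS : Set.InjOn (fun j => (S j).card) s) (m : ℕ) :
    ∑' g : ι → ℕ, (∏ j, (1 / 2 : ℝ≥0∞) ^ (g j + 1)) *
      (((s.filter fun j => ∀ q ∈ S j, g q < m).card : ℕ) : ℝ≥0∞) ≤ 2 ^ m := by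
  simp_rw [Finset.card_filter, Nat.cast_sum, Nat.cast_ite, Nat.cast_one, Nat.cast_zero,
    Finset.mul_sum]
  rw [Summable.tsum_finsetSum fun _ _ => ENNReal.summable]
  simp_rw [tsum_geom_indicator]
  exact (sum_pow_le_tsum_of_injOn s _ hS _).trans_eq (tsum_geomLT_pow m)

/-- **Expected number of descendants of a node of rank `k` (Theorem 5, first part).**
Let `k ∈ ℕ`, let `i` be a fixed index in `Fin n`, let the ranks `r j` for `j ≠ i` be
independent geometric random variables with `P(r j = m) = 1/2^(m+1)` (modelled by the
product PMF `μ` on `{j // j ≠ i} → ℕ`), let the rank of node `i` be exactly `k`, and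
let `T g` be the (unique) zip tree on nodes with keys `0, …, n−1` and these ranks.
Then the expected number of descendants of node `i` (the nodes of the subtree rooted
at `i`, including `i` itself) is at most `3·2^k − 1`. -/
theorem expected_descendants_of_rank (n k : ℕ) (i : Fin n)
    (μ : PMF (({j : Fin n // j ≠ i}) → ℕ))
    (hμ : ∀ g : {j : Fin n // j ≠ i} → ℕ,
        μ g = ∏ j : {j : Fin n // j ≠ i}, (1 / 2 : ℝ≥0∞) ^ (g j + 1))
    (T : ({j : Fin n // j ≠ i} → ℕ) → ZTree ℕ)
    (hT : ∀ g : {j : Fin n // j ≠ i} → ℕ, (T g).isZipTree ∧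
        (T g).nodes.Perm ((List.finRange n).map
          fun j : Fin n => ((j : ℕ), if h : j = i then k else g ⟨j, h⟩))) :
    ∑' g : {j : Fin n // j ≠ i} → ℕ,
        μ g * ((((T g).subtreeAt (i : ℕ)).nodes.length : ℕ) : ℝ≥0∞) ≤
      3 * (2 : ℝ≥0∞) ^ k - 1 := by
  have hcardL : ∀ j ∈ Finset.Iic i, ((Finset.Ico j i).subtype (· ≠ i)).card = i - j := by
    intro j _
    rw [Finset.card_subtype, Finset.filter_true_of_mem, Fin.card_Ico]
    exact fun x hx => (Finset.mem_Ico.1 hx).2.ne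
  have hcardR : ∀ j ∈ Finset.Ici i, ((Finset.Ioc i j).subtype (· ≠ i)).card = j - i := by
    intro j _
    rw [Finset.card_subtype, Finset.filter_true_of_mem, Fin.card_Ioc]
    exact fun x hx => (Finset.mem_Ioc.1 hx).1.ne'
  have hL := tsum_geom_card_filter_le (Finset.Iic i)
    (fun j => (Finset.Ico j i).subtype (· ≠ i)) (fun a ha b hb hab => by
      have hab : ((Finset.Ico a i).subtype (· ≠ i)).card =
        ((Finset.Ico b i).subtype (· ≠ i)).card := hab
      rw [hcardL a ha, hcardL b hb] at hab
      have ha := Finset.mem_Iic.1 (Finset.mem_coe.1 ha)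
      have hb := Finset.mem_Iic.1 (Finset.mem_coe.1 hb)
      omega) k
  have hR := tsum_geom_card_filter_le (Finset.Ici i)
    (fun j => (Finset.Ioc i j).subtype (· ≠ i)) (fun a ha b hb hab => by
      have hab : ((Finset.Ioc i a).subtype (· ≠ i)).card =
        ((Finset.Ioc i b).subtype (· ≠ i)).card := hab
      rw [hcardR a ha, hcardR b hb] at hab
      have ha := Finset.mem_Ici.1 (Finset.mem_coe.1 ha)
      have hb := Finset.mem_Ici.1 (Finset.mem_coe.1 hb)
      omega) (k + 1)
  refine ENNReal.le_sub_of_add_le_right ENNReal.one_ne_top ?_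
  calc _ = ∑' g, μ g * ((((T g).subtreeAt (i : ℕ)).nodes.length + 1 : ℕ) : ℝ≥0∞) := by
        conv_lhs => rw [← μ.tsum_coe, ← ENNReal.tsum_add]
        exact tsum_congr fun g => by push_cast; ring
    _ ≤ 2 ^ k + 2 ^ (k + 1) := by
        refine le_trans ?_ (add_le_add hL hR)
        rw [← ENNReal.tsum_add]
        refine ENNReal.tsum_le_tsum fun g => ?_
        rw [hμ, ← mul_add, ← Nat.cast_add]
        refine mul_le_mul' le_rfl (Nat.cast_le.2 ?_)
        exact length_subtreeAt_add_one_le (hT g).1 (hT g).2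
    _ = 3 * 2 ^ k := by ring
end
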